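/- arXiv:1506.01202 — 5 statements merged into one kernel-verified Lean document; each statement's English description precedes it below -/
import Mathlib

section
/- The classifying map Ξ maps 𝓒 into 𝒳, and it induces a bijection from the quotient 𝓒/L onto the quotient 𝒳/Λ_P; both quotients have exactly ω³ elements. -/
noncomputable section
open scoped Classical

/-- The representative of `x` modulo `2ℤ` lying in `[-1,1)`.  For the values arising in the
plaid model (which are never congruent to an odd integer modulo `2ℤ`) this is the unique
representative in `(-1,1)`. -/
def nrm (x : ℝ) : ℝ := x - 2 * ⌊(x + 1) / 2⌋

/-- An even rational parameter `p/q`: coprime positive integers `p < q` with `p*q` even. -/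
structure Param where
  p : ℕ
  q : ℕ
  p_pos : 0 < p
  p_lt_q : p < q
  coprime : Nat.Coprime p q
  even_pq : Even (p * q)

/-- `z` lies on a line of the family `𝓗` (horizontal lines with integer `y`-coordinate). -/
def onH (z : ℝ × ℝ) : Prop := ∃ n : ℤ, z.2 = (n : ℝ)

/-- `z` lies on a line of the family `𝓥` (vertical lines with integer `x`-coordinate). -/
def onV (z : ℝ × ℝ) : Prop := ∃ n : ℤ, z.1 = (n : ℝ)

/-- The lightness condition on the pair of values `(F_A(z), F_B(z))`:
`F_A(z)·F_B(z) > 0` and `|F_B(z)| < |F_A(z)|`. -/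
def lightPair (a b : ℝ) : Prop := a * b > 0 ∧ |b| < |a|

namespace Param

variable (π : Param)

def ω : ℕ := π.p + π.q

def P : ℝ := 2 * π.p / π.ω

def Q : ℝ := 2 * π.q / π.ω

/-- `z` lies on a line of `𝓟` (slope `-P`, integer `y`-intercept). -/
def onP (z : ℝ × ℝ) : Prop := ∃ n : ℤ, z.2 + π.P * z.1 = (n : ℝ)

/-- `z` lies on a line of `𝓠` (slope `-Q`, integer `y`-intercept). -/
def onQ (z : ℝ × ℝ) : Prop := ∃ n : ℤ, z.2 + π.Q * z.1 = (n : ℝ)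

def FH (z : ℝ × ℝ) : ℝ := nrm (2 * π.P * z.2)
def FV (z : ℝ × ℝ) : ℝ := nrm (2 * π.P * z.1)
def FP (z : ℝ × ℝ) : ℝ := nrm (π.P * z.2 + π.P ^ 2 * z.1 + 1)
def FQ (z : ℝ × ℝ) : ℝ := nrm (π.P * z.2 + π.P * π.Q * z.1 + 1)

/-- `z` is a light intersection point of type `P` on a horizontal (`𝓗`) line. -/
def lightHP (z : ℝ × ℝ) : Prop := onH z ∧ π.onP z ∧ lightPair (π.FH z) (π.FP z)

/-- `z` is a light intersection point of type `Q` on a horizontal (`𝓗`) line. -/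
def lightHQ (z : ℝ × ℝ) : Prop := onH z ∧ π.onQ z ∧ lightPair (π.FH z) (π.FQ z)

/-- `z` is a light intersection point of type `P` on a vertical (`𝓥`) line. -/
def lightVP (z : ℝ × ℝ) : Prop := onV z ∧ π.onP z ∧ lightPair (π.FV z) (π.FP z)

/-- `z` is a light intersection point of type `Q` on a vertical (`𝓥`) line. -/
def lightVQ (z : ℝ × ℝ) : Prop := onV z ∧ π.onQ z ∧ lightPair (π.FV z) (π.FQ z)

/-- `z` is a light point (of some kind). -/
def light (z : ℝ × ℝ) : Prop := π.lightHP z ∨ π.lightHQ z ∨ π.lightVP z ∨ π.lightVQ z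

/-- The number of light points, with the double-counting convention (a light point which is the
midpoint of the segment, lying simultaneously on a `𝓟` line and a `𝓠` line, counts twice), on
the horizontal unit segment from `(m,n)` to `(m+1,n)`. -/
def hLightCount (m n : ℤ) : ℕ :=
  Set.ncard {x : ℝ | x ∈ Set.Icc (m : ℝ) ((m : ℝ) + 1) ∧ π.lightHP (x, (n : ℝ))} +
  Set.ncard {x : ℝ | x ∈ Set.Icc (m : ℝ) ((m : ℝ) + 1) ∧ π.lightHQ (x, (n : ℝ)) ∧
    (π.onP (x, (n : ℝ)) → x = (m : ℝ) + 1 / 2)}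

/-- The number of light points on the vertical unit segment from `(m,n)` to `(m,n+1)`. -/
def vLightCount (m n : ℤ) : ℕ :=
  Set.ncard {y : ℝ | y ∈ Set.Icc (n : ℝ) ((n : ℝ) + 1) ∧ π.lightVP ((m : ℝ), y)} +
  Set.ncard {y : ℝ | y ∈ Set.Icc (n : ℝ) ((n : ℝ) + 1) ∧ π.lightVQ ((m : ℝ), y)}

/-- The horizontal unit segment from `(m,n)` to `(m+1,n)` is good: it contains exactly one
light point (with the double-counting convention). -/
def goodH (m n : ℤ) : Prop := π.hLightCount m n = 1

/-- The vertical unit segment from `(m,n)` to `(m,n+1)` is good. -/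
def goodV (m n : ℤ) : Prop := π.vLightCount m n = 1

end Param

/-- The set `𝓒` of centers of integer unit squares: `(ℤ + 1/2)²`. -/
def CSet : Set (ℝ × ℝ) := {z | ∃ m n : ℤ, z = ((m : ℝ) + 1 / 2, (n : ℝ) + 1 / 2)}

/-- The classifying map `Ξ(x,y) = (2Px + 2y, 2Px, 2Px + 2Py)` (before taking the quotient by
the lattice `Λ_P`). -/
def Xi (P : ℝ) (z : ℝ × ℝ) : ℝ × ℝ × ℝ :=
  (2 * P * z.1 + 2 * z.2, 2 * P * z.1, 2 * P * z.1 + 2 * P * z.2)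

/-- Membership in the lattice `Λ_P ⊂ ℝ³` generated by `(2,P,P)`, `(0,2,0)`, `(0,0,2)`. -/
def ΛMem (P : ℝ) (v : ℝ × ℝ × ℝ) : Prop :=
  ∃ a b c : ℤ, v = ((2 * a : ℝ), (a : ℝ) * P + 2 * b, (a : ℝ) * P + 2 * c)

/-- The equivalence `z ∼ z'` modulo the lattice `L ⊂ ℤ²` generated by `(ω²,0)` and `(0,ω)`. -/
def LRel (ω : ℕ) (z z' : ℝ × ℝ) : Prop :=
  ∃ a b : ℤ, z' - z = ((ω : ℝ) ^ 2 * a, (ω : ℝ) * b)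

/-- The set `𝒳 = (ℤ_odd/ω) × (ℤ_even/ω) × (ℤ_even/ω) ⊂ ℝ³`. -/
def XSet (ω : ℕ) : Set (ℝ × ℝ × ℝ) :=
  {v | ∃ a b c : ℤ, Odd a ∧ Even b ∧ Even c ∧
        v = ((a : ℝ) / ω, (b : ℝ) / ω, (c : ℝ) / ω)}

/-- The representative of `v ∈ ℝ³` modulo the lattice `Λ_P` lying in the fundamental domain
`[-1,1)³`: first subtract the appropriate multiple of `(2,P,P)`, then reduce the last two
coordinates mod `2ℤ`. -/
def repΛ (P : ℝ) (v : ℝ × ℝ × ℝ) : ℝ × ℝ × ℝ :=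
  (nrm v.1, nrm (v.2.1 - (⌊(v.1 + 1) / 2⌋ : ℤ) * P), nrm (v.2.2 - (⌊(v.1 + 1) / 2⌋ : ℤ) * P))

lemma Param.omega_pos (π : Param) : (0 : ℝ) < π.ω := by
  have := π.p_pos
  have : 0 < π.ω := by unfold Param.ω; omega
  exact_mod_cast this

lemma Param.omega_odd (π : Param) : Odd (π.ω : ℤ) := by
  have h := π.even_pq
  have hc := π.coprime
  unfold Param.ω
  rcases Nat.even_or_odd π.p with h1 | h1 <;> rcases Nat.even_or_odd π.q with h2 | h2
  · exfalso
    have := Nat.dvd_gcd h1.two_dvd h2.two_dvd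
    rw [hc] at this
    omega
  · exact_mod_cast h1.add_odd h2
  · exact_mod_cast h1.add_even h2
  · exact absurd h (Nat.not_even_iff_odd.2 (h1.mul h2))

lemma Param.cop_p (π : Param) : IsCoprime (π.p : ℤ) (π.ω : ℤ) := by
  have : Nat.Coprime π.p π.ω := by
    unfold Param.ω
    simpa using π.coprime
  exact Nat.isCoprime_iff_coprime.2 this

lemma Param.cop_2 (π : Param) : IsCoprime (2 : ℤ) (π.ω : ℤ) := by
  obtain ⟨h, hh⟩ := π.omega_odd
  exact ⟨-h, 1, by rw [hh]; ring⟩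

lemma solve_mod {a w : ℤ} (h : IsCoprime a w) (t : ℤ) : ∃ x k : ℤ, a * x = t + w * k := by
  obtain ⟨u, v, huv⟩ := h
  exact ⟨t * u, -(v * t), by linear_combination t * huv⟩

lemma LambdaMem_iff (π : Param) (u v w : ℤ) :
    ΛMem π.P ((u : ℝ) / π.ω, (v : ℝ) / π.ω, (w : ℝ) / π.ω) ↔
    ∃ a b c : ℤ, u = 2 * a * π.ω ∧ v = 2 * π.p * a + 2 * b * π.ω ∧
      w = 2 * π.p * a + 2 * c * π.ω := by
  have hw := π.omega_pos.ne'
  unfold ΛMem Param.P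
  refine exists_congr fun a => exists_congr fun b => exists_congr fun c => ?_
  rw [Prod.mk.injEq, Prod.mk.injEq]
  refine and_congr ?_ (and_congr ?_ ?_)
  · rw [div_eq_iff hw]
    exact_mod_cast Iff.rfl
  · rw [div_eq_iff hw, show ((a : ℝ) * (2 * π.p / π.ω) + 2 * b) * π.ω
      = 2 * π.p * a + 2 * b * π.ω by field_simp]
    exact_mod_cast Iff.rfl
  · rw [div_eq_iff hw, show ((a : ℝ) * (2 * π.p / π.ω) + 2 * c) * π.ω
      = 2 * π.p * a + 2 * c * π.ω by field_simp]
    exact_mod_cast Iff.rfl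

lemma Xi_eq (π : Param) (m n : ℤ) :
    Xi π.P ((m : ℝ) + 1 / 2, (n : ℝ) + 1 / 2) =
      (((2 * π.p * (2 * m + 1) + π.ω * (2 * n + 1) : ℤ) : ℝ) / π.ω,
       ((2 * π.p * (2 * m + 1) : ℤ) : ℝ) / π.ω,
       ((2 * π.p * (2 * m + 1) + 2 * π.p * (2 * n + 1) : ℤ) : ℝ) / π.ω) := by
  have hw := π.omega_pos.ne'
  unfold Xi Param.P
  refine Prod.ext ?_ (Prod.ext ?_ ?_) <;> (push_cast; field_simp)

lemma part1 (π : Param) : ∀ z ∈ CSet, Xi π.P z ∈ XSet π.ω := by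
  rintro z ⟨m, n, rfl⟩
  refine ⟨_, _, _, ?_, ?_, ?_, Xi_eq π m n⟩
  · have h1 : Even (2 * (π.p : ℤ) * (2 * m + 1)) := ⟨π.p * (2 * m + 1), by ring⟩
    have h2 : Odd ((π.ω : ℤ) * (2 * n + 1)) := π.omega_odd.mul ⟨n, rfl⟩
    exact h1.add_odd h2
  · exact ⟨π.p * (2 * m + 1), by ring⟩
  · exact ⟨π.p * (2 * m + 1) + π.p * (2 * n + 1), by ring⟩

lemma LRel_iff (π : Param) (m n m' n' : ℤ) :
    LRel π.ω ((m : ℝ) + 1 / 2, (n : ℝ) + 1 / 2) ((m' : ℝ) + 1 / 2, (n' : ℝ) + 1 / 2) ↔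
    ∃ a b : ℤ, m' - m = (π.ω : ℤ) ^ 2 * a ∧ n' - n = π.ω * b := by
  unfold LRel
  refine exists_congr fun a => exists_congr fun b => ?_
  rw [Prod.mk_sub_mk, Prod.mk.injEq]
  rw [show (m' : ℝ) + 1 / 2 - (m + 1 / 2) = m' - m by ring,
    show (n' : ℝ) + 1 / 2 - (n + 1 / 2) = n' - n by ring]
  exact_mod_cast Iff.rfl

lemma part2 (π : Param) : ∀ z ∈ CSet, ∀ z' ∈ CSet,
    (ΛMem π.P (Xi π.P z' - Xi π.P z) ↔ LRel π.ω z z') := by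
  rintro z ⟨m, n, rfl⟩ z' ⟨m', n', rfl⟩
  rw [Xi_eq, Xi_eq, Prod.mk_sub_mk, Prod.mk_sub_mk, ← sub_div, ← sub_div, ← sub_div,
    ← Int.cast_sub, ← Int.cast_sub, ← Int.cast_sub, LambdaMem_iff, LRel_iff]
  have hw : (π.ω : ℤ) ≠ 0 := by
    have := π.omega_pos.ne'
    exact_mod_cast this
  have c1 := π.cop_p
  have c2 : IsCoprime (2 * π.p : ℤ) (π.ω : ℤ) := π.cop_2.mul_left c1
  have c4 : IsCoprime (2 * (2 * π.p) : ℤ) (π.ω : ℤ) := π.cop_2.mul_left c2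
  have two : (2 : ℤ) ≠ 0 := by norm_num
  constructor
  · rintro ⟨a, b, c, h1, h2, h3⟩
    obtain ⟨s, hs⟩ : (π.ω : ℤ) ∣ m' - m := by
      refine c4.symm.dvd_of_dvd_mul_left ⟨2 * a - 2 * (n' - n), ?_⟩
      linear_combination h1
    obtain ⟨t, ht⟩ : (π.ω : ℤ) ∣ n' - n := by
      refine c2.symm.dvd_of_dvd_mul_left ⟨c - b, ?_⟩
      apply mul_left_cancel₀ two
      linear_combination h3 - h2
    obtain ⟨r, hr⟩ : (π.ω : ℤ) ∣ a := by
      refine c2.symm.dvd_of_dvd_mul_left ⟨4 * π.p * s - 2 * b, ?_⟩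
      linear_combination 4 * π.p * hs - h2
    have ha : a = π.ω * t + 2 * π.p * s := by
      apply mul_left_cancel₀ hw
      apply mul_left_cancel₀ two
      linear_combination -h1 + 4 * π.p * hs + 2 * π.ω * ht
    obtain ⟨x, hx⟩ : (π.ω : ℤ) ∣ s := by
      refine c2.symm.dvd_of_dvd_mul_left ⟨r - t, ?_⟩
      linear_combination hr - ha
    exact ⟨x, t, by rw [hs, hx]; ring, ht⟩
  · rintro ⟨s, t, hs, ht⟩
    refine ⟨π.ω * (t + 2 * π.p * s), 2 * π.p * π.ω * s - π.p * (t + 2 * π.p * s),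
      2 * π.p * π.ω * s - π.p * (t + 2 * π.p * s) + 2 * π.p * t, ?_, ?_, ?_⟩
    · linear_combination 4 * π.p * hs + 2 * π.ω * ht
    · linear_combination 4 * π.p * hs
    · linear_combination 4 * π.p * hs + 4 * π.p * ht

lemma part3 (π : Param) : ∀ v ∈ XSet π.ω, ∃ z ∈ CSet, ΛMem π.P (Xi π.P z - v) := by
  rintro v ⟨α, β', γ', hα, ⟨β, rfl⟩, ⟨γ, rfl⟩, rfl⟩
  have c1 := π.cop_p
  have c2 : IsCoprime (2 * π.p : ℤ) (π.ω : ℤ) := π.cop_2.mul_left c1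
  have c4 : IsCoprime (2 * (2 * π.p) : ℤ) (π.ω : ℤ) := π.cop_2.mul_left c2
  have c3 : IsCoprime (π.p * (2 * π.p) : ℤ) (π.ω : ℤ) := c1.mul_left c2
  obtain ⟨m, k, hm⟩ := solve_mod c4 (α - 2 * π.p)
  obtain ⟨n, l, hn⟩ := solve_mod c2 (γ - β - π.p)
  have hk : Odd k := by
    have h1 : Odd ((π.ω : ℤ) * k) := by
      have e : (π.ω : ℤ) * k = 2 * (2 * π.p * m + π.p) - α := by linear_combination -hm
      rw [e]
      exact (even_two_mul _).sub_odd hα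
    exact (Int.odd_mul.1 h1).2
  obtain ⟨k', rfl⟩ := hk
  obtain ⟨s, j, hs⟩ := solve_mod c3 (π.p * (2 * m + 1) - β - π.p * (k' + n + 1))
  refine ⟨_, ⟨m + π.ω * s, n, rfl⟩, ?_⟩
  rw [Xi_eq, Prod.mk_sub_mk, Prod.mk_sub_mk, ← sub_div, ← sub_div, ← sub_div,
    ← Int.cast_sub, ← Int.cast_sub, ← Int.cast_sub, LambdaMem_iff]
  refine ⟨k' + n + 1 + 2 * π.p * s, 2 * π.p * s - j, 2 * π.p * s - j + l, ?_, ?_, ?_⟩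
  · linear_combination hm
  · linear_combination -2 * hs
  · linear_combination -2 * hs + 2 * hn

lemma part4 (π : Param) : ∃ T : Finset (ℝ × ℝ), ↑T ⊆ CSet ∧ T.card = π.ω ^ 3 ∧
      ∀ z ∈ CSet, ∃! t, t ∈ T ∧ LRel π.ω t z := by
  have hw : (0 : ℤ) < π.ω := by
    have := π.omega_pos
    exact_mod_cast this
  have hw2 : (0 : ℤ) < (π.ω : ℤ) ^ 2 := by positivity
  let f : ℤ × ℤ → ℝ × ℝ := fun x => ((x.1 : ℝ) + 1 / 2, (x.2 : ℝ) + 1 / 2)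
  have hf : Function.Injective f := by
    rintro ⟨a, b⟩ ⟨c, d⟩ h
    simpa [f] using h
  refine ⟨(Finset.Ico (0 : ℤ) ((π.ω : ℤ) ^ 2) ×ˢ Finset.Ico (0 : ℤ) π.ω).image f, ?_, ?_, ?_⟩
  · intro z hz
    obtain ⟨x, -, rfl⟩ := Finset.mem_image.1 (Finset.mem_coe.1 hz)
    exact ⟨x.1, x.2, rfl⟩
  · rw [Finset.card_image_of_injective _ hf, Finset.card_product, Int.card_Ico, Int.card_Ico]
    have : ((π.ω : ℤ) ^ 2 - 0).toNat = π.ω ^ 2 := by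
      rw [sub_zero, ← Nat.cast_pow, Int.toNat_natCast]
    rw [this, sub_zero, Int.toNat_natCast]
    ring
  · rintro z ⟨m, n, rfl⟩
    refine ⟨f (m % (π.ω : ℤ) ^ 2, n % π.ω), ⟨?_, ?_⟩, ?_⟩
    · refine Finset.mem_image_of_mem _ ?_
      simp only [Finset.mem_product, Finset.mem_Ico]
      exact ⟨⟨Int.emod_nonneg _ hw2.ne', Int.emod_lt_of_pos _ hw2⟩,
        ⟨Int.emod_nonneg _ hw.ne', Int.emod_lt_of_pos _ hw⟩⟩
    · refine (LRel_iff π _ _ _ _).2 ⟨m / (π.ω : ℤ) ^ 2, n / π.ω, ?_, ?_⟩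
      · linear_combination -(Int.emod_add_mul_ediv m ((π.ω : ℤ) ^ 2))
      · linear_combination -(Int.emod_add_mul_ediv n (π.ω : ℤ))
    · rintro t ⟨ht, hr⟩
      obtain ⟨⟨c, d⟩, hx, rfl⟩ := Finset.mem_image.1 ht
      simp only [Finset.mem_product, Finset.mem_Ico] at hx
      obtain ⟨a, b, ha, hb⟩ := (LRel_iff π _ _ _ _).1 hr
      obtain ⟨⟨h1, h2⟩, h3, h4⟩ := hx
      congr 1
      refine Prod.ext ?_ ?_
      · change c = m % _
        rw [show m = c + (π.ω : ℤ) ^ 2 * a by linear_combination ha, Int.add_mul_emod_self_left,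
          Int.emod_eq_of_lt h1 h2]
      · change d = n % _
        rw [show n = d + (π.ω : ℤ) * b by linear_combination hb, Int.add_mul_emod_self_left,
          Int.emod_eq_of_lt h3 h4]

lemma LambdaMem_sub {P : ℝ} {u v : ℝ × ℝ × ℝ} (hu : ΛMem P u) (hv : ΛMem P v) :
    ΛMem P (u - v) := by
  obtain ⟨a, b, c, rfl⟩ := hu
  obtain ⟨d, e, f, rfl⟩ := hv
  refine ⟨a - d, b - e, c - f, ?_⟩
  rw [Prod.mk_sub_mk, Prod.mk_sub_mk]
  refine Prod.ext ?_ (Prod.ext ?_ ?_) <;> (push_cast; ring)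

lemma LambdaMem_zero {P : ℝ} : ΛMem P 0 := ⟨0, 0, 0, by simp; rfl⟩

lemma part5 (π : Param) : ∃ T : Finset (ℝ × ℝ × ℝ), ↑T ⊆ XSet π.ω ∧ T.card = π.ω ^ 3 ∧
      ∀ v ∈ XSet π.ω, ∃! t, t ∈ T ∧ ΛMem π.P (v - t) := by
  obtain ⟨T, hT, hc, hu⟩ := part4 π
  have key : ∀ s ∈ T, ∀ t ∈ T, ∀ z ∈ CSet, ΛMem π.P (Xi π.P z - Xi π.P s) →
      ΛMem π.P (Xi π.P z - Xi π.P t) → s = t := by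
    intro s hs t ht z hz h1 h2
    exact (hu z hz).unique ⟨hs, (part2 π s (hT hs) z hz).1 h1⟩
      ⟨ht, (part2 π t (hT ht) z hz).1 h2⟩
  refine ⟨T.image (Xi π.P), ?_, ?_, ?_⟩
  · intro v hv
    obtain ⟨t, ht, rfl⟩ := Finset.mem_image.1 (Finset.mem_coe.1 hv)
    exact part1 π t (hT ht)
  · rw [Finset.card_image_of_injOn, hc]
    intro s hs t ht h
    refine key s hs t ht s (hT hs) ?_ ?_
    · rw [sub_self]; exact LambdaMem_zero
    · rw [h, sub_self]; exact LambdaMem_zero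
  · intro v hv
    obtain ⟨z, hz, hzv⟩ := part3 π v hv
    obtain ⟨t, ⟨ht, htz⟩, -⟩ := hu z hz
    have h1 := (part2 π t (hT ht) z hz).2 htz
    refine ⟨Xi π.P t, ⟨Finset.mem_image_of_mem _ ht, ?_⟩, ?_⟩
    · have := LambdaMem_sub h1 hzv
      rwa [show Xi π.P z - Xi π.P t - (Xi π.P z - v) = v - Xi π.P t by abel] at this
    · rintro _ ⟨hw, hm⟩
      obtain ⟨s, hs, rfl⟩ := Finset.mem_image.1 hw
      have h2 := LambdaMem_sub hm (LambdaMem_sub LambdaMem_zero hzv)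
      rw [show v - Xi π.P s - (0 - (Xi π.P z - v)) = Xi π.P z - Xi π.P s by abel] at h2
      rw [key s hs t ht z hz h2 h1]

/-- The classifying map `Ξ` maps `𝓒` into `𝒳` and induces a bijection from `𝓒/L` onto
`𝒳/Λ_P`; both quotients have exactly `ω³` elements (expressed below by the existence of
transversals of cardinality `ω³`). -/
theorem classifying_bijection (π : Param) :
    (∀ z ∈ CSet, Xi π.P z ∈ XSet π.ω) ∧
    (∀ z ∈ CSet, ∀ z' ∈ CSet, (ΛMem π.P (Xi π.P z' - Xi π.P z) ↔ LRel π.ω z z')) ∧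
    (∀ v ∈ XSet π.ω, ∃ z ∈ CSet, ΛMem π.P (Xi π.P z - v)) ∧
    (∃ T : Finset (ℝ × ℝ), ↑T ⊆ CSet ∧ T.card = π.ω ^ 3 ∧
      ∀ z ∈ CSet, ∃! t, t ∈ T ∧ LRel π.ω t z) ∧
    (∃ T : Finset (ℝ × ℝ × ℝ), ↑T ⊆ XSet π.ω ∧ T.card = π.ω ^ 3 ∧
      ∀ v ∈ XSet π.ω, ∃! t, t ∈ T ∧ ΛMem π.P (v - t)) := by
  exact ⟨part1 π, part2 π, part3 π, part4 π, part5 π⟩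
end
end

section
/- A pair (a₁, a₂) of real numbers is a good pair if and only if (a₁ − a₂, a₁ − 1) is a good pair. -/
noncomputable section

/-- `(a₁, a₂)` is a good pair: none of `a₁`, `a₂`, `a₁ - a₂` is an integer,
`⟨a₁⟩·⟨a₂⟩ > 0` and `|⟨a₁⟩| < |⟨a₂⟩|`. -/
def GoodPair (a₁ a₂ : ℝ) : Prop :=
  (∀ n : ℤ, a₁ ≠ (n : ℝ)) ∧ (∀ n : ℤ, a₂ ≠ (n : ℝ)) ∧ (∀ n : ℤ, a₁ - a₂ ≠ (n : ℝ)) ∧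
  nrm a₁ * nrm a₂ > 0 ∧ |nrm a₁| < |nrm a₂|

theorem nrm_eq_of (x : ℝ) (n : ℤ) (h1 : -1 < x - 2 * n) (h2 : x - 2 * n < 1) :
    nrm x = x - 2 * n := by
  have : ⌊(x + 1) / 2⌋ = n := by
    rw [Int.floor_eq_iff]; constructor <;> linarith
  rw [nrm, this]

theorem nrm_spec (x : ℝ) (hx : ∀ n : ℤ, x ≠ (n : ℝ)) :
    ∃ n : ℤ, nrm x = x - 2 * n ∧ -1 < x - 2 * n ∧ x - 2 * n < 1 := by
  refine ⟨⌊(x + 1) / 2⌋, rfl, ?_, ?_⟩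
  · have h := Int.floor_le ((x + 1) / 2)
    have h2 := hx (2 * ⌊(x + 1) / 2⌋ - 1)
    push_cast at h2
    refine lt_of_le_of_ne (by linarith) (fun h3 => h2 (by linarith))
  · have h := Int.lt_floor_add_one ((x + 1) / 2)
    linarith

theorem order_of_good {u v : ℝ} (h : u * v > 0) (h' : |u| < |v|) :
    (0 < u ∧ u < v) ∨ (v < u ∧ u < 0) := by
  rcases mul_pos_iff.1 h with ⟨hu, hv⟩ | ⟨hu, hv⟩
  · rw [abs_of_pos hu, abs_of_pos hv] at h'
    exact Or.inl ⟨hu, h'⟩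
  · rw [abs_of_neg hu, abs_of_neg hv] at h'
    exact Or.inr ⟨by linarith, hu⟩

theorem good_of_order {u v : ℝ} (h : (0 < u ∧ u < v) ∨ (v < u ∧ u < 0)) :
    u * v > 0 ∧ |u| < |v| := by
  rcases h with ⟨hu, hv⟩ | ⟨hv, hu⟩
  · rw [abs_of_pos hu, abs_of_pos (hu.trans hv)]
    exact ⟨mul_pos hu (hu.trans hv), hv⟩
  · rw [abs_of_neg hu, abs_of_neg (hv.trans hu)]
    exact ⟨mul_pos_of_neg_of_neg hu (hv.trans hu), by linarith⟩

/-- `(a₁, a₂)` is a good pair if and only if `(a₁ - a₂, a₁ - 1)` is a good pair. -/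
theorem goodPair_iff_swap (a₁ a₂ : ℝ) : GoodPair a₁ a₂ ↔ GoodPair (a₁ - a₂) (a₁ - 1) := by
  constructor
  · rintro ⟨h1, h2, h3, h4, h5⟩
    obtain ⟨m, em, m1, m2⟩ := nrm_spec a₁ h1
    obtain ⟨n, en, n1, n2⟩ := nrm_spec a₂ h2
    have ho := order_of_good h4 h5
    rw [em, en] at ho
    refine ⟨h3, fun k hk => h1 (k + 1) (by push_cast; linarith),
      fun k hk => h2 (1 - k) (by push_cast; linarith), ?_⟩
    apply good_of_order
    rcases ho with ⟨p, q⟩ | ⟨p, q⟩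
    · rw [nrm_eq_of (a₁ - a₂) (m - n) (by push_cast; linarith) (by push_cast; linarith),
        nrm_eq_of (a₁ - 1) m (by linarith) (by linarith)]
      right; push_cast; constructor <;> linarith
    · rw [nrm_eq_of (a₁ - a₂) (m - n) (by push_cast; linarith) (by push_cast; linarith),
        nrm_eq_of (a₁ - 1) (m - 1) (by push_cast; linarith) (by push_cast; linarith)]
      left; push_cast; constructor <;> linarith
  · rintro ⟨h1, h2, h3, h4, h5⟩
    obtain ⟨m, em, m1, m2⟩ := nrm_spec _ h1
    obtain ⟨n, en, n1, n2⟩ := nrm_spec _ h2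
    have ho := order_of_good h4 h5
    rw [em, en] at ho
    refine ⟨fun k hk => h2 (k - 1) (by push_cast; linarith),
      fun k hk => h3 (1 - k) (by push_cast; linarith), h1, ?_⟩
    apply good_of_order
    rcases ho with ⟨p, q⟩ | ⟨p, q⟩
    · rw [nrm_eq_of a₁ (n + 1) (by push_cast; linarith) (by push_cast; linarith),
        nrm_eq_of a₂ (n + 1 - m) (by push_cast; linarith) (by push_cast; linarith)]
      right; push_cast; constructor <;> linarith
    · rw [nrm_eq_of a₁ n (by linarith) (by linarith),
        nrm_eq_of a₂ (n - m) (by push_cast; linarith) (by push_cast; linarith)]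
      left; push_cast; constructor <;> linarith
end
end

section
/- Let P ∈ (0,1), Q = 2 − P, let m, k be integers, and set c = m + 1/2. If k/Q ∈ [m + 1/Q, m + 1], then [2Pc + 1]₂ ∈ [−1 + P, 1 − P]. -/
noncomputable section

/-- `nrm₂ x` is a representative of `x` modulo `2ℤ` lying in `[-2,2)` (namely the
representative in `[-1,1)`). -/
def nrm₂ (x : ℝ) : ℝ := x - 2 * ⌊(x + 1) / 2⌋

/-- Let `P ∈ (0,1)`, `Q = 2 - P`, let `m, k` be integers and `c = m + 1/2`.
If `k/Q ∈ [m + 1/Q, m + 1]` then `[2Pc + 1]₂ ∈ [-1 + P, 1 - P]`. -/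
theorem tech_interval (P : ℝ) (hP : P ∈ Set.Ioo (0 : ℝ) 1) (Q : ℝ) (hQ : Q = 2 - P)
    (m k : ℤ) (c : ℝ) (hc : c = (m : ℝ) + 1 / 2)
    (h : (k : ℝ) / Q ∈ Set.Icc ((m : ℝ) + 1 / Q) ((m : ℝ) + 1)) :
    nrm₂ (2 * P * c + 1) ∈ Set.Icc (-1 + P) (1 - P) := by
  obtain ⟨hP0, hP1⟩ := hP
  obtain ⟨h1, h2⟩ := h
  have hQ0 : 0 < Q := by linarith
  have e : (m : ℝ) + 1 / Q = (m * Q + 1) / Q := by field_simp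
  rw [e, div_le_div_iff_of_pos_right hQ0] at h1
  rw [div_le_iff₀ hQ0] at h2
  subst hQ hc
  have hf : ⌊(2 * P * ((m : ℝ) + 1 / 2) + 1 + 1) / 2⌋ = 2 * m + 2 - k := by
    rw [Int.floor_eq_iff]
    push_cast
    constructor <;> linarith
  unfold nrm₂
  rw [hf]
  push_cast
  constructor <;> linarith
end
end

section
/- Let a ∈ (0, ω) be the integer with 2ap ≡ −1 (mod ω). For every c ∈ (ℤ+1/2)², Ξ(c + (aω, 1)) − Ξ(c) ≡ (0, 0, P(1 − Paω)) (mod Λ_P), and P(1 + Paω) is an even integer. Consequently, the Ξ-images of the points c + j·(aω, 1), j ∈ ℤ, all lie in a single fiber T = const of X_P and on a single line U₁ = const in that fiber. -/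
noncomputable section
open scoped Classical

theorem nrm_add_two_mul (x : ℝ) (k : ℤ) : nrm (x + 2 * k) = nrm x := by
  unfold nrm
  have h : (x + 2 * k + 1) / 2 = (x + 1) / 2 + (k : ℝ) := by ring
  rw [h, Int.floor_add_intCast]
  push_cast
  ring

/-- Translating by a lattice vector does not change the first two coordinates of `repΛ`. -/
theorem repΛ_shift (P : ℝ) (v w : ℝ × ℝ × ℝ) (k b : ℤ) (h1 : w.1 = v.1 + 2 * k)
    (h2 : w.2.1 = v.2.1 + k * P + 2 * b) :
    (repΛ P w).1 = (repΛ P v).1 ∧ (repΛ P w).2.1 = (repΛ P v).2.1 := by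
  have h : (v.1 + 2 * k + 1) / 2 = (v.1 + 1) / 2 + (k : ℝ) := by ring
  unfold repΛ
  dsimp only
  rw [h1, h2]
  refine ⟨nrm_add_two_mul _ _, ?_⟩
  rw [h, Int.floor_add_intCast, ← nrm_add_two_mul (v.2.1 - _) b]
  congr 1
  push_cast
  ring

/-- Let `a ∈ (0,ω)` be the integer with `2ap ≡ -1 (mod ω)`.  For every center
`c = (m + 1/2, n + 1/2)` of an integer unit square,
`Ξ(c + (aω, 1)) - Ξ(c) ≡ (0, 0, P(1 - Paω)) (mod Λ_P)`, and `P(1 + Paω)` is an even integer.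
Consequently the `Ξ`-images of the points `c + j·(aω,1)`, `j ∈ ℤ`, all lie in a single fiber
`T = const` of `X_P` and on a single line `U₁ = const` in that fiber. -/
theorem vertical_particle_image (π : Param) (a : ℕ) (ha₀ : 0 < a) (ha₁ : a < π.ω)
    (ha : (2 * a * π.p : ℤ) ≡ -1 [ZMOD (π.ω : ℤ)]) :
    (∀ m n : ℤ,
      ΛMem π.P
        (Xi π.P ((m : ℝ) + 1 / 2 + (a : ℝ) * π.ω, (n : ℝ) + 1 / 2 + 1) -
          Xi π.P ((m : ℝ) + 1 / 2, (n : ℝ) + 1 / 2) -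
          (0, 0, π.P * (1 - π.P * a * π.ω)))) ∧
    (∃ e : ℤ, π.P * (1 + π.P * a * π.ω) = 2 * e) ∧
    (∀ m n : ℤ, ∀ i j : ℤ,
      (repΛ π.P (Xi π.P ((m : ℝ) + 1 / 2 + i * ((a : ℝ) * π.ω), (n : ℝ) + 1 / 2 + i))).1 =
        (repΛ π.P (Xi π.P ((m : ℝ) + 1 / 2 + j * ((a : ℝ) * π.ω), (n : ℝ) + 1 / 2 + j))).1 ∧
      (repΛ π.P (Xi π.P ((m : ℝ) + 1 / 2 + i * ((a : ℝ) * π.ω), (n : ℝ) + 1 / 2 + i))).2.1 =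
        (repΛ π.P (Xi π.P ((m : ℝ) + 1 / 2 + j * ((a : ℝ) * π.ω), (n : ℝ) + 1 / 2 + j))).2.1) := by
  have hω : (π.ω : ℝ) ≠ 0 := by
    have : 0 < π.ω := by omega
    positivity
  have hP : π.P * π.ω = 2 * π.p := by
    unfold Param.P
    field_simp
  obtain ⟨k, hk⟩ := ha.symm.dvd
  have hk' : 2 * (a : ℝ) * π.p + 1 = π.ω * k := by
    have : (2 * a * π.p + 1 : ℤ) = π.ω * k := by linarith
    exact_mod_cast this
  have hA : (2 * (a : ℝ) * π.p + 1) * π.P = 2 * π.p * k := by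
    rw [hk', ← hP]; ring
  have hPa : π.P * a * π.ω = 2 * a * π.p := by
    linear_combination (a : ℝ) * hP
  refine ⟨?_, ⟨π.p * k, ?_⟩, ?_⟩
  · intro m n
    refine ⟨2 * a * π.p + 1, 2 * a * π.p - π.p * k, 2 * a * π.p, ?_⟩
    simp only [Xi, Prod.mk_sub_mk, Prod.mk.injEq]
    push_cast
    refine ⟨?_, ?_, ?_⟩
    · linear_combination 2 * hPa
    · linear_combination 2 * hPa - hA
    · linear_combination (2 + π.P) * hPa
  · rw [hPa]
    push_cast
    linear_combination hA
  · have key : ∀ m n i : ℤ, _ := fun m n i =>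
      repΛ_shift π.P (Xi π.P ((m : ℝ) + 1 / 2, (n : ℝ) + 1 / 2))
        (Xi π.P ((m : ℝ) + 1 / 2 + i * ((a : ℝ) * π.ω), (n : ℝ) + 1 / 2 + i))
        (i * (2 * a * π.p + 1)) (i * (2 * a * π.p - π.p * k))
        (by
          simp only [Xi]
          push_cast
          linear_combination 2 * (i : ℝ) * hPa)
        (by
          simp only [Xi]
          push_cast
          linear_combination 2 * (i : ℝ) * hPa - (i : ℝ) * hA)
    intro m n i j
    exact ⟨(key m n i).1.trans (key m n j).1.symm, (key m n i).2.trans (key m n j).2.symm⟩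
end
end

section
/- Let a ∈ (0, ω) be the integer with 2ap ≡ −1 (mod ω). For k = 0, 1, …, 2p−1 set x_k = kaω + k/P and ĉ_k = (⌊x_k⌋ + 1/2, 0), the midpoint of the horizontal unit segment containing (x_k, 0). Then Ξ(x_k, 0) ≡ (0,0,0) (mod Λ_P), and every Ξ(ĉ_k) lies on the image modulo Λ_P of the single segment {(t, t, t) : t ∈ [−P, P]}; in particular all the points Ξ(ĉ_k) lie on one line segment in X_P parallel to the vector (1,1,1). -/
noncomputable section
open scoped Classical

/-- Let `a ∈ (0,ω)` be the integer with `2ap ≡ -1 (mod ω)`.  For `k = 0, 1, …, 2p - 1` set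
`x_k = kaω + k/P` and let `ĉ_k = (⌊x_k⌋ + 1/2, 0)` be the midpoint of the horizontal unit
segment containing `(x_k, 0)`.  Then `Ξ(x_k, 0) ≡ (0,0,0) (mod Λ_P)`, and every `Ξ(ĉ_k)` lies
on the image modulo `Λ_P` of the single segment `{(t,t,t) : t ∈ [-P,P]}`; in particular all
the points `Ξ(ĉ_k)` lie on one line segment in `X_P` parallel to `(1,1,1)`. -/
theorem horizontal_particle_image (π : Param) (a : ℕ) (ha₀ : 0 < a) (ha₁ : a < π.ω)
    (ha : (2 * a * π.p : ℤ) ≡ -1 [ZMOD (π.ω : ℤ)])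
    (k : ℕ) (hk : k < 2 * π.p) :
    ΛMem π.P (Xi π.P (((k : ℝ) * a * π.ω + (k : ℝ) / π.P, 0))) ∧
    ∃ t ∈ Set.Icc (-π.P) π.P,
      ΛMem π.P (Xi π.P ((⌊(k : ℝ) * a * π.ω + (k : ℝ) / π.P⌋ : ℝ) + 1 / 2, 0) -
        (t, t, t)) := by
  obtain ⟨m, hm⟩ := ha.symm.dvd
  have hp : (0 : ℝ) < π.p := by exact_mod_cast π.p_pos
  have hω : (0 : ℝ) < π.ω := by
    have := π.p_pos
    have h : 0 < π.ω := by unfold Param.ω; omega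
    exact_mod_cast h
  have hP : 0 < π.P := by unfold Param.P; positivity
  have hPω : π.P * π.ω = 2 * π.p := by unfold Param.P; field_simp
  have hm' : 2 * (a : ℝ) * π.p + 1 = π.ω * m := by
    have h : (2 * a * π.p : ℤ) + 1 = π.ω * m := by linarith
    exact_mod_cast h
  set x : ℝ := (k : ℝ) * a * π.ω + (k : ℝ) / π.P with hx
  have hxP : π.P * x = k * (π.ω * m) := by
    have h1 : π.P * x = k * a * (π.P * π.ω) + k := by rw [hx]; field_simp
    rw [h1, hPω, ← hm']; ring
  have hAP : (k : ℝ) * (π.ω * m) * π.P = 2 * (k * m * π.p) := by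
    linear_combination (k : ℝ) * m * hPω
  refine ⟨⟨k * (π.ω * m), k * (π.ω * m) - k * m * π.p, k * (π.ω * m) - k * m * π.p, ?_⟩,
    2 * π.P * (⌊x⌋ + 1 / 2 - x), ⟨?_, ?_⟩,
    ⟨k * (π.ω * m), k * (π.ω * m) - k * m * π.p, k * (π.ω * m) - k * m * π.p, ?_⟩⟩
  · simp only [Xi, Prod.mk.injEq]
    push_cast
    refine ⟨?_, ?_, ?_⟩ <;> linarith
  · nlinarith [Int.lt_floor_add_one x]
  · nlinarith [Int.floor_le x]
  · simp only [Xi, Prod.mk_sub_mk, Prod.mk.injEq]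
    push_cast
    refine ⟨?_, ?_, ?_⟩ <;> linarith
end
end
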